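/- arXiv:1404.1092 — 3 statements merged into one kernel-verified Lean document; each statement's English description precedes it below -/
import Mathlib

section
/- Let τ₁, τ₂ ∈ ℂ with Im τ₁ ≠ 0 and Im τ₂ ≠ 0. Suppose (k₁⁽¹⁾, k₂⁽¹⁾, k₃⁽¹⁾, k₄⁽¹⁾) and (k₁⁽²⁾, k₂⁽²⁾, k₃⁽²⁾, k₄⁽²⁾) are two vectors in ℚ⁴ that are linearly independent over ℚ, and that for j = 1, 2 one has k₁⁽ʲ⁾ + k₂⁽ʲ⁾·conj(τ₂) + k₃⁽ʲ⁾·τ₁ + k₄⁽ʲ⁾·τ₁·conj(τ₂) = 0. Then k₂⁽¹⁾·k₄⁽²⁾ − k₂⁽²⁾·k₄⁽¹⁾ ≠ 0. -/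
open ComplexConjugate

/-- A complex number with nonzero imaginary part satisfies no nontrivial rational linear
relation with `1`. -/
theorem Complex.eq_zero_of_ratCast_add_mul_eq_zero {τ : ℂ} (hτ : τ.im ≠ 0) {p q : ℚ}
    (h : (p : ℂ) + (q : ℂ) * τ = 0) : p = 0 ∧ q = 0 := by
  have hq : q = 0 := by simpa [hτ] using congrArg Complex.im h
  subst hq
  exact ⟨by simpa using h, rfl⟩

theorem stmt1 (τ₁ τ₂ : ℂ) (hτ₁ : τ₁.im ≠ 0) (hτ₂ : τ₂.im ≠ 0)
    (k : Fin 2 → Fin 4 → ℚ) (hk : LinearIndependent ℚ k)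
    (hrel : ∀ j : Fin 2,
      (k j 0 : ℂ) + (k j 1 : ℂ) * conj τ₂ + (k j 2 : ℂ) * τ₁ +
        (k j 3 : ℂ) * τ₁ * conj τ₂ = 0) :
    k 0 1 * k 1 3 - k 1 1 * k 0 3 ≠ 0 := by
  intro hdet
  have key : ∀ a b : ℚ, a * k 0 1 + b * k 1 1 = 0 → a * k 0 3 + b * k 1 3 = 0 →
      a = 0 ∧ b = 0 := by
    intro a b h1 h3
    have h1' : (a : ℂ) * k 0 1 + b * k 1 1 = 0 := by exact_mod_cast h1
    have h3' : (a : ℂ) * k 0 3 + b * k 1 3 = 0 := by exact_mod_cast h3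
    have hlin : ((a * k 0 0 + b * k 1 0 : ℚ) : ℂ) + ((a * k 0 2 + b * k 1 2 : ℚ) : ℂ) * τ₁ = 0 := by
      push_cast
      linear_combination a * hrel 0 + b * hrel 1 - conj τ₂ * h1' - τ₁ * conj τ₂ * h3'
    obtain ⟨h0, h2⟩ := Complex.eq_zero_of_ratCast_add_mul_eq_zero hτ₁ hlin
    have hab := Fintype.linearIndependent_iff.mp hk ![a, b] (by
      ext i
      fin_cases i <;> simpa [Fin.sum_univ_two])
    exact ⟨hab 0, hab 1⟩
  obtain ⟨h11, h01⟩ := key (k 1 1) (-k 0 1) (by ring) (by linear_combination -hdet)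
  obtain ⟨h13, h03⟩ := key (k 1 3) (-k 0 3) (by linear_combination hdet) (by ring)
  exact one_ne_zero (key 1 0 (by linear_combination -h01) (by linear_combination -h03)).1
end

section
/- Let τ₁, τ₂ ∈ ℂ with Im τ₁ ≠ 0 and Im τ₂ ≠ 0. Suppose (k₁⁽¹⁾, k₂⁽¹⁾, k₃⁽¹⁾, k₄⁽¹⁾) and (k₁⁽²⁾, k₂⁽²⁾, k₃⁽²⁾, k₄⁽²⁾) are two vectors in ℚ⁴ that are linearly independent over ℚ, and that for j = 1, 2 one has k₁⁽ʲ⁾ + k₂⁽ʲ⁾·conj(τ₂) + k₃⁽ʲ⁾·τ₁ + k₄⁽ʲ⁾·τ₁·conj(τ₂) = 0. Then conj(τ₂) satisfies the quadratic equation (k₂⁽¹⁾k₄⁽²⁾ − k₂⁽²⁾k₄⁽¹⁾)·conj(τ₂)² + (k₁⁽¹⁾k₄⁽²⁾ + k₂⁽¹⁾k₃⁽²⁾ − k₁⁽²⁾k₄⁽¹⁾ − k₂⁽²⁾k₃⁽¹⁾)·conj(τ₂) + (k₁⁽¹⁾k₃⁽²⁾ − k₁⁽²⁾k₃⁽¹⁾)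 = 0, whose leading coefficient k₂⁽¹⁾k₄⁽²⁾ − k₂⁽²⁾k₄⁽¹⁾ is nonzero. -/
open ComplexConjugate

theorem Complex.ratCast_eq_zero_of_add_mul_eq_zero {z : ℂ} (hz : z.im ≠ 0) {a c : ℚ}
    (h : (a : ℂ) + c * z = 0) : a = 0 ∧ c = 0 := by
  have hc : c = 0 := by
    have him := congrArg Complex.im h
    simpa [hz] using him
  subst hc
  exact ⟨by simpa using h, rfl⟩

/-- A rational combination of the two relation vectors in which the coefficients of `w` and
`z * w` cancel is trivial. -/
theorem LinearIndependent.eq_zero_of_bilinear_relations {z w : ℂ} (hz : z.im ≠ 0)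
    {k : Fin 2 → Fin 4 → ℚ} (hk : LinearIndependent ℚ k)
    (hrel : ∀ j, (k j 0 : ℂ) + k j 1 * w + k j 2 * z + k j 3 * z * w = 0) {p q : ℚ}
    (h₁ : p * k 0 1 + q * k 1 1 = 0) (h₃ : p * k 0 3 + q * k 1 3 = 0) : p = 0 ∧ q = 0 := by
  have h₁' : (p : ℂ) * k 0 1 + q * k 1 1 = 0 := by exact_mod_cast h₁
  have h₃' : (p : ℂ) * k 0 3 + q * k 1 3 = 0 := by exact_mod_cast h₃
  obtain ⟨h₀, h₂⟩ := Complex.ratCast_eq_zero_of_add_mul_eq_zero hz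
    (a := p * k 0 0 + q * k 1 0) (c := p * k 0 2 + q * k 1 2) (by
      push_cast
      linear_combination (p : ℂ) * hrel 0 + (q : ℂ) * hrel 1 - w * h₁' - z * w * h₃')
  have hcomb : ∑ i, ![p, q] i • k i = 0 := by
    ext i
    fin_cases i <;> simpa [Fin.sum_univ_two]
  have hzero := Fintype.linearIndependent_iff.mp hk ![p, q] hcomb
  exact ⟨hzero 0, hzero 1⟩

theorem stmt2 (τ₁ τ₂ : ℂ) (hτ₁ : τ₁.im ≠ 0) (hτ₂ : τ₂.im ≠ 0)
    (k : Fin 2 → Fin 4 → ℚ) (hk : LinearIndependent ℚ k)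
    (hrel : ∀ j : Fin 2,
      (k j 0 : ℂ) + (k j 1 : ℂ) * conj τ₂ + (k j 2 : ℂ) * τ₁ +
        (k j 3 : ℂ) * τ₁ * conj τ₂ = 0) :
    ((k 0 1 * k 1 3 - k 1 1 * k 0 3 : ℚ) : ℂ) * (conj τ₂) ^ 2 +
        ((k 0 0 * k 1 3 + k 0 1 * k 1 2 - k 1 0 * k 0 3 - k 1 1 * k 0 2 : ℚ) : ℂ) * conj τ₂ +
        ((k 0 0 * k 1 2 - k 1 0 * k 0 2 : ℚ) : ℂ) = 0 ∧
      k 0 1 * k 1 3 - k 1 1 * k 0 3 ≠ 0 := by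
  refine ⟨?_, fun hdet => ?_⟩
  · push_cast
    linear_combination ((k 1 2 : ℂ) + k 1 3 * conj τ₂) * hrel 0 -
      ((k 0 2 : ℂ) + k 0 3 * conj τ₂) * hrel 1
  · have key {p q : ℚ} := hk.eq_zero_of_bilinear_relations hτ₁ hrel (p := p) (q := q)
    obtain ⟨h13, h03⟩ := key (p := k 1 3) (q := -k 0 3)
      (by linear_combination hdet) (by ring)
    rw [neg_eq_zero] at h03
    obtain ⟨h11, h01⟩ := key (p := k 1 1) (q := -k 0 1) (by ring) (by simp [h13, h03])
    rw [neg_eq_zero] at h01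
    exact one_ne_zero (key (p := 1) (q := 0) (by simp [h01]) (by simp [h03])).1
end

section
/- Let τ₁, τ₂ ∈ ℂ with Im τ₁ ≠ 0 and Im τ₂ ≠ 0. Suppose (k₁⁽¹⁾, k₂⁽¹⁾, k₃⁽¹⁾, k₄⁽¹⁾) and (k₁⁽²⁾, k₂⁽²⁾, k₃⁽²⁾, k₄⁽²⁾) are two vectors in ℚ⁴ that are linearly independent over ℚ, and that for j = 1, 2 one has k₁⁽ʲ⁾ + k₂⁽ʲ⁾·conj(τ₂) + k₃⁽ʲ⁾·τ₁ + k₄⁽ʲ⁾·τ₁·conj(τ₂) = 0. Then τ₂ is algebraic over ℚ and the field extension ℚ(τ₂)/ℚ has degree exactly 2, i.e., the minimal polynomial of τ₂ over ℚ has degree 2. -/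
open ComplexConjugate

theorem rat_coeffs_eq_zero_of_add_mul_eq_zero {z : ℂ} (hz : z.im ≠ 0) {p q : ℚ}
    (h : (p : ℂ) + q * z = 0) : p = 0 ∧ q = 0 := by
  have hq : q = 0 := by
    have him := congrArg Complex.im h
    simpa [hz] using him
  subst hq
  exact ⟨by simpa using h, rfl⟩

theorem mul_sub_mul_ne_zero_of_bilinear_relation {z w : ℂ} (hz : z.im ≠ 0) (hw : w.im ≠ 0)
    {a b c d : ℚ} (h : (a : ℂ) + b * w + c * z + d * z * w = 0)
    (h0 : ¬ (a = 0 ∧ b = 0 ∧ c = 0 ∧ d = 0)) : a * d - b * c ≠ 0 := by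
  intro hD
  have hD' : (a : ℂ) * d - b * c = 0 := by exact_mod_cast hD
  by_cases hQ : (c : ℂ) + d * w = 0
  · have hP : (a : ℂ) + b * w = 0 := by linear_combination h - z * hQ
    obtain ⟨hc, hd⟩ := rat_coeffs_eq_zero_of_add_mul_eq_zero hw hQ
    obtain ⟨ha, hb⟩ := rat_coeffs_eq_zero_of_add_mul_eq_zero hw hP
    exact h0 ⟨ha, hb, hc, hd⟩
  · have h1 : (b : ℂ) + d * z = 0 := by
      refine (mul_eq_zero.mp ?_).resolve_right hQ
      linear_combination d * h - hD'
    have h2 : (a : ℂ) + c * z = 0 := by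
      refine (mul_eq_zero.mp ?_).resolve_right hQ
      linear_combination c * h + w * hD'
    obtain ⟨hb, hd⟩ := rat_coeffs_eq_zero_of_add_mul_eq_zero hz h1
    obtain ⟨ha, hc⟩ := rat_coeffs_eq_zero_of_add_mul_eq_zero hz h2
    exact h0 ⟨ha, hb, hc, hd⟩

theorem minpoly_natDegree_eq_two_of_quadratic {z : ℂ} (hz : z.im ≠ 0) {A B C : ℚ}
    (h0 : ¬ (A = 0 ∧ B = 0 ∧ C = 0)) (h : (A : ℂ) * z ^ 2 + B * z + C = 0) :
    IsAlgebraic ℚ z ∧ (minpoly ℚ z).natDegree = 2 := by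
  set p : Polynomial ℚ :=
    Polynomial.C A * Polynomial.X ^ 2 + Polynomial.C B * Polynomial.X + Polynomial.C C with hp
  have hp0 : p ≠ 0 := by
    intro hpz
    refine h0 ⟨?_, ?_, ?_⟩
    · simpa [hp, Polynomial.coeff_X, Polynomial.coeff_C] using
        congrArg (fun r => Polynomial.coeff r 2) hpz
    · simpa [hp, Polynomial.coeff_X, Polynomial.coeff_C] using
        congrArg (fun r => Polynomial.coeff r 1) hpz
    · simpa [hp, Polynomial.coeff_X, Polynomial.coeff_C] using
        congrArg (fun r => Polynomial.coeff r 0) hpz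
  have hroot : Polynomial.aeval z p = 0 := by simpa [hp] using h
  have halg : IsAlgebraic ℚ z := ⟨p, hp0, hroot⟩
  refine ⟨halg, le_antisymm ?_ ?_⟩
  · exact (Polynomial.natDegree_le_natDegree (minpoly.degree_le_of_ne_zero ℚ z hp0 hroot)).trans
      Polynomial.natDegree_quadratic_le
  · rw [minpoly.two_le_natDegree_iff halg.isIntegral]
    rintro ⟨q, rfl⟩
    simp at hz

theorem stmt3 (τ₁ τ₂ : ℂ) (hτ₁ : τ₁.im ≠ 0) (hτ₂ : τ₂.im ≠ 0)
    (k : Fin 2 → Fin 4 → ℚ) (hk : LinearIndependent ℚ k)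
    (hrel : ∀ j : Fin 2,
      (k j 0 : ℂ) + (k j 1 : ℂ) * conj τ₂ + (k j 2 : ℂ) * τ₁ +
        (k j 3 : ℂ) * τ₁ * conj τ₂ = 0) :
    IsAlgebraic ℚ τ₂ ∧ (minpoly ℚ τ₂).natDegree = 2 := by
  have hconj : (conj τ₂).im ≠ 0 := by simpa using hτ₂
  have hk0 : ¬ (k 0 0 = 0 ∧ k 0 1 = 0 ∧ k 0 2 = 0 ∧ k 0 3 = 0) := by
    rintro ⟨h0, h1, h2, h3⟩
    refine hk.ne_zero 0 ?_
    ext i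
    fin_cases i <;> assumption
  have hD := mul_sub_mul_ne_zero_of_bilinear_relation hτ₁ hconj (hrel 0) hk0
  refine minpoly_natDegree_eq_two_of_quadratic hτ₂
    (A := k 0 1 * k 1 3 - k 1 1 * k 0 3)
    (B := k 0 0 * k 1 3 + k 0 1 * k 1 2 - k 1 0 * k 0 3 - k 1 1 * k 0 2)
    (C := k 0 0 * k 1 2 - k 1 0 * k 0 2) ?_ ?_
  · rintro ⟨hA, hB, hC⟩
    have h12 : k 0 1 * k 1 2 - k 1 1 * k 0 2 = 0 := by
      refine (mul_eq_zero.mp ?_).resolve_left hD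
      grind
    have h01 : k 0 0 * k 1 1 - k 1 0 * k 0 1 = 0 := by
      refine (mul_eq_zero.mp ?_).resolve_left hD
      grind
    have h23 : k 0 2 * k 1 3 - k 1 2 * k 0 3 = 0 := by
      refine (mul_eq_zero.mp ?_).resolve_left hD
      grind
    have hminor : ∀ i j, k 1 i * k 0 j + -k 0 i * k 1 j = 0 := by
      intro i j
      fin_cases i <;> fin_cases j <;> simp only [Fin.reduceFinMk, Fin.mk_one, Fin.zero_eta] <;>
        linarith
    have hpair : LinearIndependent ℚ ![k 0, k 1] := by
      convert hk using 1
      ext j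
      fin_cases j <;> rfl
    have hzero : ∀ i, k 0 i = 0 := fun i =>
      neg_eq_zero.mp (LinearIndependent.pair_iff.mp hpair (k 1 i) (-k 0 i)
        (funext (hminor i))).2
    exact hk0 ⟨hzero 0, hzero 1, hzero 2, hzero 3⟩
  · have hs : ((k 0 1 * k 1 3 - k 1 1 * k 0 3 : ℚ) : ℂ) * conj τ₂ ^ 2 +
        ((k 0 0 * k 1 3 + k 0 1 * k 1 2 - k 1 0 * k 0 3 - k 1 1 * k 0 2 : ℚ) : ℂ) * conj τ₂ +
        ((k 0 0 * k 1 2 - k 1 0 * k 0 2 : ℚ) : ℂ) = 0 := by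
      push_cast
      linear_combination ((k 1 2 : ℂ) + k 1 3 * conj τ₂) * hrel 0 -
        ((k 0 2 : ℂ) + k 0 3 * conj τ₂) * hrel 1
    simpa only [map_add, map_mul, map_pow, map_ratCast, Complex.conj_conj, map_zero] using
      congrArg conj hs
end
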